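/- Let Ω be an open convex proper subset of ℝⁿ with finite inner radius δ₀ = sup_{x∈Ω} dist(x, ∂Ω). Let m > 1, ν ∈ [0, 1/m], λ ∈ [0, (1 + νm)/2), and let c > 0 satisfy (1 − 2λ)·J_ν(2c/m) + 2c·J′_ν(2c/m) = 0 with 2c/m ∈ (0, j_ν). Then for every g ∈ C₀¹(Ω) with |∇g| ∈ L²(Ω): ((1 − ν²m²)/4)·∫_Ω |g(x)|²/δ(x)² dx + ((c² + (m − 1)(λ − λ²))/δ₀^m)·∫_Ω |g(x)|²/δ(x)^{2−m} dx ≤ 4·((1 + νm)/2 − λ²)·∫_Ω |∇g(x)|² dx. -/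

import Mathlib

open MeasureTheory Real Set Filter

/-- Bessel function of the first kind of real order `ν`, defined for `x > 0` by its series. -/
noncomputable def besselJ (ν x : ℝ) : ℝ :=
  ∑' k : ℕ, (-1 : ℝ) ^ k * x ^ (2 * (k : ℝ) + ν) /
    (2 ^ (2 * (k : ℝ) + ν) * (Nat.factorial k : ℝ) * Real.Gamma ((k : ℝ) + 1 + ν))

open scoped Topology InnerProductSpace

/-- The entire part of the Bessel function: `J_μ(x) = (x / 2) ^ μ * besselEntire μ (x ^ 2 / 4)`. -/
noncomputable def besselEntire (μ s : ℝ) : ℝ :=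
  ∑' k : ℕ, (-1 : ℝ) ^ k / ((Nat.factorial k : ℝ) * Gamma ((k : ℝ) + 1 + μ)) * s ^ k

lemma inv_Gamma_le {μ : ℝ} (hμ : 0 ≤ μ) (k : ℕ) :
    (Gamma ((k : ℝ) + 1 + μ))⁻¹ ≤ 1 + (Gamma (1 + μ))⁻¹ := by
  have h1 : 0 < Gamma (1 + μ) := Gamma_pos_of_pos (by linarith)
  rcases Nat.eq_zero_or_pos k with rfl | hk
  · simp
  · have hk' : (1 : ℝ) ≤ k := by exact_mod_cast hk
    have h2 : 1 ≤ Gamma ((k : ℝ) + 1 + μ) := by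
      have h3 : (2 : ℝ) ≤ (k : ℝ) + 1 + μ := by linarith
      simpa [Gamma_two] using Gamma_strictMonoOn_Ici.monotoneOn (mem_Ici.2 le_rfl) h3 h3
    have := inv_le_one_of_one_le₀ h2
    have := inv_pos.2 h1
    linarith

lemma abs_besselEntire_coeff_le {μ : ℝ} (hμ : 0 ≤ μ) (k : ℕ) :
    |(-1 : ℝ) ^ k / ((Nat.factorial k : ℝ) * Gamma ((k : ℝ) + 1 + μ))| ≤
      (1 + (Gamma (1 + μ))⁻¹) / (Nat.factorial k : ℝ) := by
  have h0 : 0 < Gamma ((k : ℝ) + 1 + μ) := Gamma_pos_of_pos (by positivity)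
  have hk : (0 : ℝ) < Nat.factorial k := by positivity
  rw [abs_div, abs_pow, abs_neg, abs_one, one_pow, abs_of_pos (mul_pos hk h0), one_div,
    mul_inv, mul_comm, div_eq_mul_inv]
  exact mul_le_mul_of_nonneg_right (inv_Gamma_le hμ k) (by positivity)

lemma summable_besselEntire {μ : ℝ} (hμ : 0 ≤ μ) (s : ℝ) :
    Summable fun k : ℕ =>
      (-1 : ℝ) ^ k / ((Nat.factorial k : ℝ) * Gamma ((k : ℝ) + 1 + μ)) * s ^ k := by
  refine Summable.of_norm_bounded
    ((Real.summable_pow_div_factorial |s|).mul_left (1 + (Gamma (1 + μ))⁻¹)) fun k => ?_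
  rw [norm_mul, norm_pow, Real.norm_eq_abs, Real.norm_eq_abs]
  calc _ ≤ (1 + (Gamma (1 + μ))⁻¹) / (Nat.factorial k : ℝ) * |s| ^ k := by
        gcongr; exact abs_besselEntire_coeff_le hμ k
    _ = _ := by ring

lemma hasDerivAt_besselEntire {μ : ℝ} (hμ : 0 ≤ μ) (s : ℝ) :
    HasDerivAt (besselEntire μ) (-besselEntire (μ + 1) s) s := by
  set C := 1 + (Gamma (1 + μ))⁻¹
  set r := |s| + 1
  have hr : 0 ≤ r := by positivity
  have hu : Summable fun k : ℕ => C * (k * r ^ (k - 1) / (Nat.factorial k : ℝ)) := by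
    refine Summable.mul_left _ ((summable_nat_add_iff 1).1 ?_)
    refine (Real.summable_pow_div_factorial r).congr fun k => ?_
    have : (k + 1 : ℝ) ≠ 0 := by positivity
    rw [Nat.factorial_succ]
    push_cast
    field_simp
  have hs : s ∈ Metric.ball (0 : ℝ) r := by
    rw [mem_ball_zero_iff, Real.norm_eq_abs]; exact lt_add_one _
  have hbound : ∀ (k : ℕ), ∀ y ∈ Metric.ball (0 : ℝ) r,
      ‖(-1 : ℝ) ^ k / ((Nat.factorial k : ℝ) * Gamma ((k : ℝ) + 1 + μ)) * (k * y ^ (k - 1))‖ ≤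
        C * (k * r ^ (k - 1) / (Nat.factorial k : ℝ)) := by
    intro k y hy
    rw [mem_ball_zero_iff, Real.norm_eq_abs] at hy
    rw [norm_mul, norm_mul, norm_pow, Real.norm_eq_abs, Real.norm_eq_abs, Real.norm_eq_abs,
      Nat.abs_cast]
    calc _ ≤ C / (Nat.factorial k : ℝ) * (k * r ^ (k - 1)) := by
          gcongr; exact abs_besselEntire_coeff_le hμ k
      _ = _ := by ring
  have key := hasDerivAt_tsum_of_isPreconnected (𝕜 := ℝ) hu Metric.isOpen_ball
    (convex_ball (0 : ℝ) r).isPreconnected (fun k y _ => (hasDerivAt_pow k y).const_mul _)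
    hbound hs (summable_besselEntire hμ s) hs
  have hsum := Summable.of_norm_bounded hu fun k => hbound k s hs
  refine key.congr_deriv ?_
  rw [hsum.tsum_eq_zero_add, besselEntire, ← tsum_neg]
  simp only [Nat.cast_zero, zero_mul, mul_zero, zero_add, Nat.add_sub_cancel]
  refine tsum_congr fun k => ?_
  have h0 : Gamma ((k : ℝ) + 1 + (μ + 1)) ≠ 0 := (Gamma_pos_of_pos (by positivity)).ne'
  have hk : (k + 1 : ℝ) ≠ 0 := by positivity
  have e : ((k + 1 : ℕ) : ℝ) + 1 + μ = (k : ℝ) + 1 + (μ + 1) := by push_cast; ring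
  rw [e, Nat.factorial_succ, pow_succ]
  push_cast
  field_simp

lemma besselEntire_recurrence {μ : ℝ} (hμ : 0 ≤ μ) (s : ℝ) :
    besselEntire μ s = (μ + 1) * besselEntire (μ + 1) s - s * besselEntire (μ + 2) s := by
  have S0 := summable_besselEntire hμ s
  have S1 := summable_besselEntire (μ := μ + 1) (by linarith) s
  have S2 := summable_besselEntire (μ := μ + 2) (by linarith) s
  unfold besselEntire
  rw [S0.tsum_eq_zero_add, S1.tsum_eq_zero_add, mul_add, ← tsum_mul_left, ← tsum_mul_left,
    add_sub_assoc, ← Summable.tsum_sub (((summable_nat_add_iff 1).2 S1).mul_left _)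
      (S2.mul_left _)]
  have hG : ∀ x : ℝ, 0 < x → Gamma (x + 1) = x * Gamma x := fun x hx => Gamma_add_one hx.ne'
  congr 1
  · have h0 : Gamma (μ + 1) ≠ 0 := (Gamma_pos_of_pos (by positivity)).ne'
    have e : ((0 : ℕ) : ℝ) + 1 + (μ + 1) = (μ + 1) + 1 := by push_cast; ring
    have e' : ((0 : ℕ) : ℝ) + 1 + μ = (μ + 1) := by push_cast; ring
    rw [e, hG _ (by positivity), e']
    have : μ + 1 ≠ 0 := by positivity
    simp
    field_simp
  · refine tsum_congr fun k => ?_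
    have h0 : Gamma ((k : ℝ) + 2 + μ) ≠ 0 := (Gamma_pos_of_pos (by positivity)).ne'
    have e : ((k + 1 : ℕ) : ℝ) + 1 + μ = (k : ℝ) + 2 + μ := by push_cast; ring
    have e1 : ((k + 1 : ℕ) : ℝ) + 1 + (μ + 1) = ((k : ℝ) + 2 + μ) + 1 := by push_cast; ring
    have e2 : (k : ℝ) + 1 + (μ + 2) = ((k : ℝ) + 2 + μ) + 1 := by ring
    rw [e, e1, e2, hG _ (by positivity), Nat.factorial_succ]
    have hk : (k + 1 : ℝ) ≠ 0 := by positivity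
    have hk' : (k : ℝ) + 2 + μ ≠ 0 := by positivity
    push_cast
    field_simp
    ring

/-- Nonnegativity propagates from order `μ` to order `μ + 1`, because
`(s ^ (μ + 1) * besselEntire (μ + 1) s)' = s ^ μ * besselEntire μ s`. -/
lemma besselEntire_add_one_nonneg {μ s₀ : ℝ} (hμ : 0 ≤ μ)
    (h : ∀ s ∈ Ioc 0 s₀, 0 ≤ besselEntire μ s) :
    ∀ s ∈ Ioc 0 s₀, 0 ≤ besselEntire (μ + 1) s := by
  intro s hs
  have hcont : Continuous (besselEntire (μ + 1)) := continuous_iff_continuousAt.2 fun x =>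
    (hasDerivAt_besselEntire (by linarith) x).continuousAt
  have hmono : MonotoneOn (fun x => x ^ (μ + 1) * besselEntire (μ + 1) x) (Icc 0 s₀) := by
    refine monotoneOn_of_hasDerivWithinAt_nonneg (f' := fun x => x ^ μ * besselEntire μ x)
      (convex_Icc 0 s₀) ?_ ?_ ?_
    · exact ((Real.continuous_rpow_const (by linarith)).mul hcont).continuousOn
    · intro x hx
      rw [interior_Icc] at hx
      have h1 := (Real.hasDerivAt_rpow_const (x := x) (p := μ + 1) (Or.inl hx.1.ne')).mul
        (hasDerivAt_besselEntire (μ := μ + 1) (by linarith) x)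
      refine (h1.congr_deriv ?_).hasDerivWithinAt
      rw [besselEntire_recurrence hμ, add_sub_cancel_right, Real.rpow_add_one hx.1.ne',
        show μ + 1 + 1 = μ + 2 by ring]
      ring
    · intro x hx
      rw [interior_Icc] at hx
      exact mul_nonneg (Real.rpow_nonneg hx.1.le _) (h x ⟨hx.1, hx.2.le⟩)
  have h2 := hmono (left_mem_Icc.2 (hs.1.le.trans hs.2)) ⟨hs.1.le, hs.2⟩ hs.1.le
  simp only [Real.zero_rpow (by linarith : μ + 1 ≠ 0), zero_mul] at h2
  exact nonneg_of_mul_nonneg_right h2 (Real.rpow_pos_of_pos hs.1 _)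

lemma besselJ_eq {ν x : ℝ} (hx : 0 < x) :
    besselJ ν x = (x / 2) ^ ν * besselEntire ν (x ^ 2 / 4) := by
  unfold besselJ besselEntire
  rw [← tsum_mul_left]
  refine tsum_congr fun k => ?_
  have e : ∀ y : ℝ, 0 < y → y ^ (2 * (k : ℝ) + ν) = (y ^ 2) ^ k * y ^ ν := fun y hy => by
    rw [Real.rpow_add hy, Real.rpow_mul hy.le, Real.rpow_natCast]; norm_num
  rw [e x hx, e 2 two_pos, Real.div_rpow hx.le two_pos.le, div_pow]
  norm_num
  have : (2 : ℝ) ^ ν ≠ 0 := by positivity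
  field_simp

lemma hasDerivAt_besselJ {ν x : ℝ} (hν : 0 ≤ ν) (hx : 0 < x) :
    HasDerivAt (besselJ ν) ((x / 2) ^ ν *
      (ν * besselEntire ν (x ^ 2 / 4) - x ^ 2 / 2 * besselEntire (ν + 1) (x ^ 2 / 4)) / x) x := by
  have h1 : HasDerivAt (fun y : ℝ => (y / 2) ^ ν) (1 / 2 * ν * (x / 2) ^ (ν - 1)) x :=
    ((hasDerivAt_id x).div_const 2).rpow_const (Or.inl (by simp; positivity))
  have h2 : HasDerivAt (fun y : ℝ => besselEntire ν (y ^ 2 / 4))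
      (-besselEntire (ν + 1) (x ^ 2 / 4) * (2 * x / 4)) x := by
    have h := (hasDerivAt_pow 2 x).div_const 4
    norm_num at h
    exact HasDerivAt.comp (h := fun y : ℝ => y ^ 2 / 4) x
      (hasDerivAt_besselEntire hν (x ^ 2 / 4)) h
  have h3 := (h1.mul h2).congr_of_eventuallyEq
    (f₁ := besselJ ν) ((eventually_gt_nhds hx).mono fun y hy => besselJ_eq hy)
  refine h3.congr_deriv ?_
  rw [Real.rpow_sub_one (by positivity)]
  field_simp
  ring

/-- The root of `(1 - 2 λ) J_ν(2c/m) + 2c J_ν'(2c/m)` below the first zero of `J_ν` satisfies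
`c² ≤ (a - λ)(2a + m - 1)` with `a = (1 + ν m) / 2`. -/
lemma sq_le_of_besselJ_root {m ν lam c jν : ℝ} (hm : 1 < m) (hν : 0 ≤ ν)
    (hjν_first : ∀ t ∈ Ioo 0 jν, 0 < besselJ ν t) (hcm : 2 * c / m ∈ Ioo 0 jν)
    (hroot : (1 - 2 * lam) * besselJ ν (2 * c / m)
      + 2 * c * deriv (besselJ ν) (2 * c / m) = 0) :
    c ^ 2 ≤ ((1 + ν * m) / 2 - lam) * (ν * m + m) := by
  set x := 2 * c / m with hxdef
  have hx : 0 < x := hcm.1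
  have hm0 : 0 < m := by linarith
  have hc : 2 * c = m * x := by rw [hxdef]; field_simp
  have hpos : ∀ s ∈ Ioc 0 (x ^ 2 / 4), 0 < besselEntire ν s := by
    intro s hs
    have hs0 : 0 < √s := Real.sqrt_pos.2 hs.1
    have hsx : 2 * √s ≤ x := by
      have : √s ≤ x / 2 := Real.sqrt_le_iff.2 ⟨by positivity, by nlinarith [hs.2]⟩
      linarith
    have := hjν_first (2 * √s) ⟨by positivity, hsx.trans_lt hcm.2⟩
    rw [besselJ_eq (by positivity), mul_pow, Real.sq_sqrt hs.1.le] at this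
    rw [show 2 ^ 2 * s / 4 = s by ring] at this
    exact pos_of_mul_pos_right this (by positivity)
  have hmem : x ^ 2 / 4 ∈ Ioc 0 (x ^ 2 / 4) := ⟨by positivity, le_rfl⟩
  have h1 := besselEntire_add_one_nonneg hν fun s hs => (hpos s hs).le
  have h2 := besselEntire_add_one_nonneg (by linarith) h1 _ hmem
  have hP := hpos _ hmem
  have hrec := besselEntire_recurrence hν (x ^ 2 / 4)
  rw [show ν + 1 + 1 = ν + 2 by ring] at h2
  rw [(hasDerivAt_besselJ hν hx).deriv, besselJ_eq hx, hc] at hroot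
  set P := besselEntire ν (x ^ 2 / 4)
  set P₁ := besselEntire (ν + 1) (x ^ 2 / 4)
  set P₂ := besselEntire (ν + 2) (x ^ 2 / 4)
  have hroot' : (1 - 2 * lam) * P + m * (ν * P - x ^ 2 / 2 * P₁) = 0 := by
    have h0 : (x / 2) ^ ν ≠ 0 := by positivity
    apply mul_left_cancel₀ h0
    rw [mul_zero, ← hroot]
    field_simp
  have hPP : P ≤ (ν + 1) * P₁ := by
    have : 0 ≤ x ^ 2 / 4 * P₂ := by positivity
    linarith
  have h3 : m * (x ^ 2 / 2) * P ≤ (1 - 2 * lam + m * ν) * (ν + 1) * P := by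
    have : m * (x ^ 2 / 2) * P ≤ m * (x ^ 2 / 2) * ((ν + 1) * P₁) := by gcongr
    nlinarith
  have h4 := le_of_mul_le_mul_right h3 hP
  have h5 : c = m * x / 2 := by linarith
  rw [h5]
  nlinarith

lemma ball_infDist_frontier_subset {E : Type*} [NormedAddCommGroup E] [NormedSpace ℝ E]
    [FiniteDimensional ℝ E] {Ω : Set E} {x : E} (hx : x ∈ Ω) (hΩ : Ω ≠ univ) :
    Metric.ball x (Metric.infDist x (frontier Ω)) ⊆ Ω := by
  obtain ⟨y, hy, hxy⟩ := exists_mem_frontier_infDist_compl_eq_dist hx hΩ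
  refine (Metric.ball_subset_ball ?_).trans Metric.ball_infDist_compl_subset
  rw [hxy]
  exact Metric.infDist_le_dist_of_mem hy

lemma infDist_frontier_pos {E : Type*} [NormedAddCommGroup E] [NormedSpace ℝ E]
    {Ω : Set E} (hΩo : IsOpen Ω) (hΩ : Ω ≠ univ) {x : E} (hx : x ∈ Ω) :
    0 < Metric.infDist x (frontier Ω) := by
  refine (isClosed_frontier.notMem_iff_infDist_pos
    (nonempty_frontier_iff.2 ⟨⟨x, hx⟩, hΩ⟩)).1 fun h => ?_
  rw [hΩo.frontier_eq] at h
  exact h.2 hx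

/-- The distance to the boundary of a convex open set has a supergradient of unit norm
at every point of the set. -/
lemma exists_unit_supergradient_infDist_frontier {E : Type*} [NormedAddCommGroup E]
    [InnerProductSpace ℝ E] [FiniteDimensional ℝ E] {Ω : Set E} (hΩo : IsOpen Ω)
    (hΩconv : Convex ℝ Ω) (hΩproper : Ω ≠ univ) {x : E} (hx : x ∈ Ω) :
    ∃ u : E, ‖u‖ = 1 ∧ ∀ y ∈ Ω,
      Metric.infDist y (frontier Ω) ≤ Metric.infDist x (frontier Ω) + ⟪u, y - x⟫_ℝ := by
  have hne : (frontier Ω).Nonempty := nonempty_frontier_iff.2 ⟨⟨x, hx⟩, hΩproper⟩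
  obtain ⟨p, hp, hpd⟩ := isClosed_frontier.exists_infDist_eq_dist hne x
  have hpΩ : p ∉ Ω := fun h => by
    rw [hΩo.frontier_eq] at hp
    exact hp.2 h
  obtain ⟨f, hf⟩ := geometric_hahn_banach_open_point hΩconv hΩo hpΩ
  set v := (InnerProductSpace.toDual ℝ E).symm f with hv
  have hfv : ∀ y, f y = ⟪v, y⟫_ℝ := fun y => by rw [hv, InnerProductSpace.toDual_symm_apply]
  have hv0 : v ≠ 0 := by
    intro h0
    have := hf x hx
    simp [hfv, h0] at this
  have hvn : 0 < ‖v‖ := norm_pos_iff.2 hv0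
  have key : ∀ y ∈ Ω, ⟪v, y⟫_ℝ + Metric.infDist y (frontier Ω) * ‖v‖ ≤ ⟪v, p⟫_ℝ := by
    intro y hy
    have hr : ∀ r ∈ Ico 0 (Metric.infDist y (frontier Ω)), ⟪v, y⟫_ℝ + r * ‖v‖ ≤ ⟪v, p⟫_ℝ := by
      intro r hr
      have hmem : y + (r / ‖v‖) • v ∈ Ω := by
        apply ball_infDist_frontier_subset hy hΩproper
        rw [Metric.mem_ball, dist_self_add_left, norm_smul, norm_div, norm_norm,
          div_mul_cancel₀ _ hvn.ne', Real.norm_of_nonneg hr.1]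
        exact hr.2
      have h1 := (hf _ hmem).le
      rw [hfv, hfv, inner_add_right, real_inner_smul_right, real_inner_self_eq_norm_sq] at h1
      calc _ = ⟪v, y⟫_ℝ + r / ‖v‖ * ‖v‖ ^ 2 := by field_simp
        _ ≤ _ := h1
    have h0 : ⟪v, y⟫_ℝ ≤ ⟪v, p⟫_ℝ := by simpa [hfv] using (hf y hy).le
    by_contra! hlt
    have hq : (⟪v, p⟫_ℝ - ⟪v, y⟫_ℝ) / ‖v‖ < Metric.infDist y (frontier Ω) := by
      rw [div_lt_iff₀ hvn]; linarith
    obtain ⟨r, hr1, hr2⟩ := exists_between hq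
    have h2 := hr r ⟨(div_nonneg (by linarith) hvn.le).trans hr1.le, hr2⟩
    rw [div_lt_iff₀ hvn] at hr1
    linarith
  refine ⟨-(‖v‖⁻¹ • v), ?_, fun y hy => ?_⟩
  · rw [norm_neg, norm_smul, norm_inv, norm_norm, inv_mul_cancel₀ hvn.ne']
  · have h1 := key y hy
    have h2 : ⟪v, p - x⟫_ℝ ≤ ‖v‖ * Metric.infDist x (frontier Ω) := by
      rw [hpd, dist_comm, dist_eq_norm]; exact real_inner_le_norm _ _
    rw [inner_sub_right] at h2
    rw [inner_neg_left, real_inner_smul_left, inner_sub_right]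
    have h3 : Metric.infDist y (frontier Ω) * ‖v‖ ≤
        (Metric.infDist x (frontier Ω) + -(‖v‖⁻¹ * (⟪v, y⟫_ℝ - ⟪v, x⟫_ℝ))) * ‖v‖ := by
      have e : (Metric.infDist x (frontier Ω) + -(‖v‖⁻¹ * (⟪v, y⟫_ℝ - ⟪v, x⟫_ℝ))) * ‖v‖ =
          Metric.infDist x (frontier Ω) * ‖v‖ - (⟪v, y⟫_ℝ - ⟪v, x⟫_ℝ) := by
        field_simp
        ring
      rw [e]; linarith
    exact le_of_mul_le_mul_right h3 hvn

/-- A uniform second difference estimate for a twice differentiable function on `(0, ∞)`. -/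
lemma exists_second_difference_le {f f' f'' : ℝ → ℝ}
    (hf : ∀ t, 0 < t → HasDerivAt f (f' t) t) (hf' : ∀ t, 0 < t → HasDerivAt f' (f'' t) t)
    (hf'' : ContinuousOn f'' (Ioi 0)) {τ R ε : ℝ} (hτ : 0 < τ) (hε : 0 < ε) :
    ∃ η > 0, ∀ t ∈ Icc (2 * τ) R, ∀ s, |s| ≤ η →
      f (t + s) + f (t - s) - 2 * f t ≤ s ^ 2 * (f'' t + ε) := by
  have huc : UniformContinuousOn f'' (Icc τ (R + τ)) :=
    isCompact_Icc.uniformContinuousOn_of_continuous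
      (hf''.mono fun t ht => hτ.trans_le ht.1)
  obtain ⟨δ, hδ, hδ'⟩ := Metric.uniformContinuousOn_iff.1 huc ε hε
  refine ⟨min τ (δ / 2), by positivity, fun t ht s hs => ?_⟩
  have hs1 : |s| ≤ τ := hs.trans (min_le_left _ _)
  have hs2 : |s| < δ := (hs.trans (min_le_right _ _)).trans_lt (by linarith)
  set M := f'' t + ε
  set D := Icc (t - |s|) (t + |s|)
  have hD0 : ∀ y ∈ D, 0 < y := fun y hy => by linarith [hy.1, ht.1]
  have hconc : ConcaveOn ℝ D fun y => f y - M / 2 * y ^ 2 := by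
    have hd : ∀ y, 0 < y → HasDerivAt (fun y => f y - M / 2 * y ^ 2) (f' y - M * y) y := by
      intro y hy
      refine ((hf y hy).sub ((hasDerivAt_pow 2 y).const_mul (M / 2))).congr_deriv ?_
      norm_num; ring
    refine concaveOn_of_hasDerivWithinAt2_nonpos (f' := fun y => f' y - M * y)
      (f'' := fun y => f'' y - M) (convex_Icc _ _)
      (fun y hy => (hd y (hD0 y hy)).continuousAt.continuousWithinAt)
      (fun y hy => (hd y (hD0 y (interior_subset hy))).hasDerivWithinAt)
      (fun y hy => ?_) (fun y hy => ?_)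
    · refine (((hf' y (hD0 y (interior_subset hy))).sub
        ((hasDerivAt_id y).const_mul M)).congr_deriv ?_).hasDerivWithinAt
      ring
    · have hy' := interior_subset hy
      have hyt : |y - t| ≤ |s| := abs_le.2 ⟨by linarith [hy'.1], by linarith [hy'.2]⟩
      have := hδ' y ⟨by linarith [hy'.1, ht.1], by linarith [hy'.2, ht.2]⟩ t
        ⟨by linarith [ht.1], by linarith [ht.2]⟩ (by rw [Real.dist_eq]; linarith)
      rw [Real.dist_eq] at this
      linarith [(abs_lt.1 this).2]
  have hp : t + s ∈ D := ⟨by linarith [neg_abs_le s], by linarith [le_abs_self s]⟩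
  have hn : t - s ∈ D := ⟨by linarith [le_abs_self s], by linarith [neg_abs_le s]⟩
  have h := hconc.2 hp hn (by norm_num : (0 : ℝ) ≤ 1 / 2) (by norm_num : (0 : ℝ) ≤ 1 / 2)
    (by norm_num)
  simp only [smul_eq_mul] at h
  rw [show (1 : ℝ) / 2 * (t + s) + 1 / 2 * (t - s) = t by ring] at h
  linarith

lemma integrable_indicator_const_of_isCompact {E : Type*} [TopologicalSpace E] [T2Space E]
    [MeasurableSpace E] [BorelSpace E] {μ : Measure E} [IsFiniteMeasureOnCompacts μ] {K : Set E}
    (hK : IsCompact K) (C : ℝ) : Integrable (K.indicator fun _ => C) μ :=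
  (integrable_indicator_iff hK.measurableSet).2 (integrableOn_const hK.measure_lt_top.ne)

lemma tendsto_integral_sq_difference_quotient {E : Type*} [NormedAddCommGroup E]
    [NormedSpace ℝ E] [FiniteDimensional ℝ E] [MeasurableSpace E] [BorelSpace E]
    {μ : Measure E} [IsFiniteMeasureOnCompacts μ] {g : E → ℝ} (hg : ContDiff ℝ 1 g)
    (hsupp : HasCompactSupport g) (v : E) :
    Tendsto (fun h : ℝ => ∫ x, ((g (x + h • v) - g x) / h) ^ 2 ∂μ) (𝓝[>] 0)
      (𝓝 (∫ x, (fderiv ℝ g x v) ^ 2 ∂μ)) := by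
  obtain ⟨C, hC⟩ := hg.lipschitzWith_of_hasCompactSupport hsupp one_ne_zero
  have hK : IsCompact (Metric.cthickening ‖v‖ (tsupport g)) := hsupp.isCompact.cthickening
  have hsmall : ∀ᶠ h : ℝ in 𝓝[>] 0, h ∈ Ioo (0 : ℝ) 1 := Ioo_mem_nhdsGT one_pos
  refine tendsto_integral_filter_of_dominated_convergence
    ((Metric.cthickening ‖v‖ (tsupport g)).indicator fun _ => (C * ‖v‖) ^ 2) ?_ ?_
    (integrable_indicator_const_of_isCompact hK _) ?_
  · refine Eventually.of_forall fun h => Continuous.aestronglyMeasurable ?_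
    have := hg.continuous
    fun_prop
  · filter_upwards [hsmall] with h hh
    refine Eventually.of_forall fun x => ?_
    by_cases hx : x ∈ Metric.cthickening ‖v‖ (tsupport g)
    · rw [indicator_of_mem hx, norm_pow, norm_div, Real.norm_of_nonneg hh.1.le]
      have h1 := hC.dist_le_mul (x + h • v) x
      rw [dist_eq_norm, dist_self_add_left, norm_smul, Real.norm_of_nonneg hh.1.le] at h1
      refine pow_le_pow_left₀ (div_nonneg (norm_nonneg _) hh.1.le) ?_ 2
      rw [div_le_iff₀ hh.1]
      linarith
    · rw [indicator_of_notMem hx]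
      have h1 : g x = 0 := image_eq_zero_of_notMem_tsupport fun h' =>
        hx (Metric.self_subset_cthickening _ h')
      have h2 : g (x + h • v) = 0 := image_eq_zero_of_notMem_tsupport fun h' =>
        hx (Metric.mem_cthickening_of_dist_le _ _ _ _ h' (by
          rw [dist_self_add_right, norm_smul, Real.norm_of_nonneg hh.1.le]
          exact mul_le_of_le_one_left (norm_nonneg _) hh.2.le))
      simp [h1, h2]
  · refine Eventually.of_forall fun x => ?_
    have h1 : HasLineDerivAt ℝ g (fderiv ℝ g x v) x v :=
      ((hg.differentiable one_ne_zero) x).hasFDerivAt.hasLineDerivAt v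
    have h2 := (hasDerivAt_iff_tendsto_slope_zero.1 h1).mono_left
      (nhdsWithin_mono 0 (fun h (hh : 0 < h) => hh.ne'))
    refine (h2.pow 2).congr fun h => ?_
    simp only [zero_add, zero_smul, add_zero, smul_eq_mul]
    rw [div_eq_inv_mul]

/-- Summation by parts for second differences, combined with a pointwise upper bound. -/
lemma integral_mul_second_difference_le {E : Type*} [NormedAddCommGroup E] [NormedSpace ℝ E]
    [FiniteDimensional ℝ E] [MeasurableSpace E] [BorelSpace E]
    {μ : Measure E} [μ.IsAddHaarMeasure] {g Y Q : E → ℝ}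
    (hg : Continuous g) (hgs : HasCompactSupport g) (hY : Continuous Y) (hQ : Continuous Q)
    (hQs : HasCompactSupport Q) (v : E)
    (hpic : ∀ x, (Y (x + v) - Y x) * (Q (x + v) - Q x) ≤ (g (x + v) - g x) ^ 2) :
    ∫ x, Q x * (2 * Y x - Y (x + v) - Y (x - v)) ∂μ ≤ ∫ x, (g (x + v) - g x) ^ 2 ∂μ := by
  have hQv : HasCompactSupport fun x => Q (x + v) := hQs.comp_homeomorph (Homeomorph.addRight v)
  have hgv : HasCompactSupport fun x => g (x + v) := hgs.comp_homeomorph (Homeomorph.addRight v)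
  have i1 : Integrable (fun x => Y x * Q x) μ :=
    (hY.mul hQ).integrable_of_hasCompactSupport hQs.mul_left
  have i2 : Integrable (fun x => Y (x + v) * Q (x + v)) μ :=
    Continuous.integrable_of_hasCompactSupport (by fun_prop) hQv.mul_left
  have i3 : Integrable (fun x => Y (x + v) * Q x) μ :=
    Continuous.integrable_of_hasCompactSupport (by fun_prop) hQs.mul_left
  have i4 : Integrable (fun x => Y x * Q (x + v)) μ :=
    Continuous.integrable_of_hasCompactSupport (by fun_prop) hQv.mul_left
  have i5 : Integrable (fun x => Y (x - v) * Q x) μ :=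
    Continuous.integrable_of_hasCompactSupport (by fun_prop) hQs.mul_left
  have i6 : Integrable (fun x => (g (x + v) - g x) ^ 2) μ := by
    refine Continuous.integrable_of_hasCompactSupport (by fun_prop) ?_
    exact (hgv.sub hgs).comp_left (g := fun y : ℝ => y ^ 2) (by simp)
  have j1 : Integrable (fun x => Y x * Q x + Y x * Q x) μ := i1.add i1
  have j1' : Integrable (fun x => Y x * Q x + Y x * Q x - Y (x + v) * Q x) μ := j1.sub i3
  have j2 : Integrable (fun x => Y (x + v) * Q (x + v) + Y x * Q x) μ := i2.add i1
  have j2' : Integrable (fun x => Y (x + v) * Q (x + v) + Y x * Q x - Y (x + v) * Q x) μ :=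
    j2.sub i3
  have e1 : ∫ x, Y (x + v) * Q (x + v) ∂μ = ∫ x, Y x * Q x ∂μ :=
    integral_add_right_eq_self (fun x => Y x * Q x) v
  have e2 : ∫ x, Y x * Q (x + v) ∂μ = ∫ x, Y (x - v) * Q x ∂μ := by
    have := integral_add_right_eq_self (μ := μ) (fun x => Y (x - v) * Q x) v
    simpa using this
  calc ∫ x, Q x * (2 * Y x - Y (x + v) - Y (x - v)) ∂μ
      = ∫ x, (Y x * Q x + Y x * Q x - Y (x + v) * Q x - Y (x - v) * Q x) ∂μ := by
        congr 1; ext x; ring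
    _ = ∫ x, (Y (x + v) * Q (x + v) + Y x * Q x - Y (x + v) * Q x - Y x * Q (x + v)) ∂μ := by
        rw [integral_sub j1' i5, integral_sub j1 i3, integral_add i1 i1, integral_sub j2' i4,
          integral_sub j2 i3, integral_add i2 i1, e1, e2]
    _ ≤ ∫ x, (g (x + v) - g x) ^ 2 ∂μ := by
        refine integral_mono (j2'.sub i4) i6 fun x => ?_
        have := hpic x
        simp only at this ⊢
        linarith

/-- The discrete Picone inequality. -/
lemma sub_mul_sub_sq_div_le {a b p q : ℝ} (hp : 0 < p) (hq : 0 < q) :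
    (q - p) * (b ^ 2 / q - a ^ 2 / p) ≤ (b - a) ^ 2 := by
  have h : (b - a) ^ 2 - (q - p) * (b ^ 2 / q - a ^ 2 / p) = (b * p - a * q) ^ 2 / (p * q) := by
    field_simp
    ring
  have : 0 ≤ (b * p - a * q) ^ 2 / (p * q) := by positivity
  linarith

lemma norm_sq_eq_sum_apply_single {n : ℕ} (L : EuclideanSpace ℝ (Fin n) →L[ℝ] ℝ) :
    ‖L‖ ^ 2 = ∑ i, (L (EuclideanSpace.single i 1)) ^ 2 := by
  set w := (InnerProductSpace.toDual ℝ (EuclideanSpace ℝ (Fin n))).symm L with hw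
  have h1 : ‖L‖ = ‖w‖ := by simp [hw]
  have h2 : ∀ y, L y = ⟪w, y⟫_ℝ := fun y => by rw [hw, InnerProductSpace.toDual_symm_apply]
  rw [h1, EuclideanSpace.norm_sq_eq]
  refine Finset.sum_congr rfl fun i _ => ?_
  rw [h2, EuclideanSpace.inner_single_right]
  simp

/-- Hardy-type inequality on a convex set from a one-dimensional increasing positive
supersolution `f'' + V f ≤ 0`. -/
lemma integral_sq_mul_potential_le {n : ℕ} {Ω : Set (EuclideanSpace ℝ (Fin n))}
    (hΩo : IsOpen Ω) (hΩconv : Convex ℝ Ω) (hΩproper : Ω ≠ univ) {δ₀ R : ℝ}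
    (hδ₀ : ∀ x ∈ Ω, Metric.infDist x (frontier Ω) ≤ δ₀) (hR : δ₀ < R) {f f' f'' V : ℝ → ℝ}
    (hfc : Continuous f) (hf : ∀ t, 0 < t → HasDerivAt f (f' t) t)
    (hf' : ∀ t, 0 < t → HasDerivAt f' (f'' t) t) (hf'' : ContinuousOn f'' (Ioi 0))
    (hV : ContinuousOn V (Ioi 0)) (hpos : ∀ t ∈ Ioo 0 R, 0 < f t)
    (hmono : MonotoneOn f (Ioo 0 R)) (hfV : ∀ t ∈ Ioo 0 R, f'' t ≤ -(V t * f t))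
    {g : EuclideanSpace ℝ (Fin n) → ℝ} (hg : ContDiff ℝ 1 g) (hsupp : HasCompactSupport g)
    (hsuppΩ : tsupport g ⊆ Ω) :
    ∫ x, g x ^ 2 * V (Metric.infDist x (frontier Ω)) ≤ ∫ x, ‖fderiv ℝ g x‖ ^ 2 := by
  set d : EuclideanSpace ℝ (Fin n) → ℝ := fun x => Metric.infDist x (frontier Ω) with hd
  have hdc : Continuous d := Metric.continuous_infDist_pt _
  have hdpos : ∀ x ∈ Ω, 0 < d x := fun x hx => infDist_frontier_pos hΩo hΩproper hx
  have hdR : ∀ x ∈ Ω, d x ∈ Ioo 0 R := fun x hx => ⟨hdpos x hx, (hδ₀ x hx).trans_lt hR⟩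
  have hg0 : ∀ x, x ∉ tsupport g → g x = 0 := fun x hx => image_eq_zero_of_notMem_tsupport hx
  set Y : EuclideanSpace ℝ (Fin n) → ℝ := fun x => f (d x) with hYdef
  have hY : Continuous Y := hfc.comp hdc
  have hYpos : ∀ x ∈ Ω, 0 < Y x := fun x hx => hpos _ (hdR x hx)
  set Q : EuclideanSpace ℝ (Fin n) → ℝ := fun x => g x ^ 2 / Y x with hQdef
  have hsub : ∀ F : EuclideanSpace ℝ (Fin n) → ℝ, (∀ x, g x = 0 → F x = 0) →
      tsupport F ⊆ tsupport g := fun F hF =>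
    closure_mono fun x hx => fun h0 => hx (hF x h0)
  have hQt : tsupport Q ⊆ tsupport g := hsub Q fun x hx => by simp [hQdef, hx]
  have hQs : HasCompactSupport Q := hsupp.of_isClosed_subset (isClosed_tsupport _) hQt
  have hQ : Continuous Q := by
    refine ContinuousOn.continuous_of_tsupport_subset (s := Ω) ?_ hΩo (hQt.trans hsuppΩ)
    exact (hg.continuous.pow 2).continuousOn.div hY.continuousOn fun x hx => (hYpos x hx).ne'
  have hQ0 : ∀ x, x ∉ tsupport g → Q x = 0 := fun x hx => by simp [hQdef, hg0 x hx]
  have hQnn : ∀ x, 0 ≤ Q x := fun x => by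
    by_cases hx : x ∈ tsupport g
    · have := hYpos x (hsuppΩ hx)
      positivity
    · rw [hQ0 x hx]
  have hW : Integrable fun x => g x ^ 2 * V (d x) := by
    have ht : tsupport (fun x => g x ^ 2 * V (d x)) ⊆ tsupport g :=
      hsub _ fun x hx => by simp [hx]
    refine Continuous.integrable_of_hasCompactSupport ?_
      (hsupp.of_isClosed_subset (isClosed_tsupport _) ht)
    refine ContinuousOn.continuous_of_tsupport_subset (s := Ω) ?_ hΩo (ht.trans hsuppΩ)
    exact (hg.continuous.pow 2).continuousOn.mul
      (hV.comp hdc.continuousOn fun x hx => hdpos x hx)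
  have hQi : Integrable Q := hQ.integrable_of_hasCompactSupport hQs
  obtain ⟨τ, hτ, hτK⟩ : ∃ τ > 0, ∀ x ∈ tsupport g, 2 * τ ≤ d x := by
    rcases (tsupport g).eq_empty_or_nonempty with h | h
    · exact ⟨1, one_pos, by simp [h]⟩
    · obtain ⟨x, hx, hmin⟩ := hsupp.isCompact.exists_isMinOn h hdc.continuousOn
      refine ⟨d x / 2, half_pos (hdpos x (hsuppΩ hx)), fun y hy => ?_⟩
      have := hmin hy
      simp only [mem_ofPred_eq] at this
      linarith
  have main : ∀ ε > 0, ∫ x, g x ^ 2 * V (d x) ≤ (∫ x, ‖fderiv ℝ g x‖ ^ 2) + ε * ∫ x, Q x := by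
    intro ε hε
    obtain ⟨η, hη, hηf⟩ := exists_second_difference_le hf hf' hf'' (R := δ₀) hτ hε
    have hlim : Tendsto (fun h : ℝ => ∑ i : Fin n,
        ∫ x, ((g (x + h • EuclideanSpace.single i (1 : ℝ)) - g x) / h) ^ 2) (𝓝[>] 0)
        (𝓝 (∫ x, ‖fderiv ℝ g x‖ ^ 2)) := by
      have e : ∫ x, ‖fderiv ℝ g x‖ ^ 2 =
          ∑ i : Fin n, ∫ x, (fderiv ℝ g x (EuclideanSpace.single i 1)) ^ 2 := by
        rw [← integral_finsetSum]
        · simp only [norm_sq_eq_sum_apply_single]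
        · intro i _
          have hc : Continuous fun x => fderiv ℝ g x (EuclideanSpace.single i 1) :=
            (hg.continuous_fderiv one_ne_zero).clm_apply continuous_const
          refine (hc.pow 2).integrable_of_hasCompactSupport
            (hsupp.of_isClosed_subset (isClosed_tsupport _) ?_)
          refine (closure_mono fun x hx => ?_).trans (tsupport_fderiv_subset ℝ)
          exact fun h0 => hx (by simp [h0])
      rw [e]
      exact tendsto_finsetSum _ fun i _ => tendsto_integral_sq_difference_quotient hg hsupp _
    rw [← sub_le_iff_le_add]
    refine ge_of_tendsto hlim ?_
    have hsmall : ∀ᶠ h : ℝ in 𝓝[>] 0, h ∈ Ioo 0 (min η (min τ (R - δ₀))) :=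
      Ioo_mem_nhdsGT (lt_min hη (lt_min hτ (by linarith)))
    filter_upwards [hsmall] with h hh
    obtain ⟨hh0, hh1⟩ := hh
    obtain ⟨hh1, hh2⟩ := lt_min_iff.1 hh1
    obtain ⟨hh2, hh3⟩ := lt_min_iff.1 hh2
    have hmem : ∀ x ∈ tsupport g, ∀ v, ‖v‖ ≤ h → x + v ∈ Ω := fun x hx v hv =>
      ball_infDist_frontier_subset (hsuppΩ hx) hΩproper (by
        rw [Metric.mem_ball, dist_self_add_left]
        have := hτK x hx
        simp only [hd] at this
        linarith)
    have hnorm : ∀ i : Fin n, ‖h • EuclideanSpace.single i (1 : ℝ)‖ = h := fun i => by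
      rw [norm_smul, PiLp.norm_single, norm_one, mul_one, Real.norm_of_nonneg hh0.le]
    have hpic : ∀ i : Fin n, ∀ x, (Y (x + h • EuclideanSpace.single i (1 : ℝ)) - Y x) *
        (Q (x + h • EuclideanSpace.single i (1 : ℝ)) - Q x) ≤
        (g (x + h • EuclideanSpace.single i (1 : ℝ)) - g x) ^ 2 := by
      intro i x
      set v := h • EuclideanSpace.single i (1 : ℝ)
      by_cases hx : x ∈ Ω
      · by_cases hxv : x + v ∈ Ω
        · exact sub_mul_sub_sq_div_le (hYpos x hx) (hYpos _ hxv)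
        · have h1 : x ∉ tsupport g := fun h' => hxv (hmem x h' v (hnorm i).le)
          have h2 : x + v ∉ tsupport g := fun h' => hxv (hsuppΩ h')
          simp [hQ0 _ h1, hQ0 _ h2, hg0 _ h1, hg0 _ h2]
      · have h1 : x ∉ tsupport g := fun h' => hx (hsuppΩ h')
        have h2 : x + v ∉ tsupport g := fun h' => hx (by
          simpa using hmem _ h' (-v) (by rw [norm_neg]; exact (hnorm i).le))
        simp [hQ0 _ h1, hQ0 _ h2, hg0 _ h1, hg0 _ h2]
    have hpt : ∀ x ∈ tsupport g, h ^ 2 * (V (d x) * Y x - ε) ≤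
        ∑ i : Fin n, (2 * Y x - Y (x + h • EuclideanSpace.single i (1 : ℝ))
          - Y (x - h • EuclideanSpace.single i (1 : ℝ))) := by
      intro x hx
      obtain ⟨u, hu, hsup⟩ := exists_unit_supergradient_infDist_frontier hΩo hΩconv hΩproper
        (hsuppΩ hx)
      have hu2 : ∑ i, u i ^ 2 = 1 := by
        have := EuclideanSpace.norm_sq_eq u
        simpa [hu] using this.symm
      have hui : ∀ i, |h * u i| ≤ h := fun i => by
        rw [abs_mul, abs_of_pos hh0]
        have h1 : u i ^ 2 ≤ 1 := hu2 ▸ Finset.single_le_sum (f := fun i => u i ^ 2)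
          (fun j _ => sq_nonneg (u j)) (Finset.mem_univ i)
        exact mul_le_of_le_one_right hh0.le (abs_le_one_iff_mul_self_le_one.2 (by nlinarith))
      have hYle : ∀ i : Fin n, ∀ σ : ℝ, |σ| = 1 →
          Y (x + σ • (h • EuclideanSpace.single i (1 : ℝ))) ≤ f (d x + σ * (h * u i)) := by
        intro i σ hσ
        have hyΩ : x + σ • (h • EuclideanSpace.single i (1 : ℝ)) ∈ Ω :=
          hmem x hx _ (by rw [norm_smul, hnorm, Real.norm_eq_abs, hσ, one_mul])
        have h1 := hsup _ hyΩ
        rw [add_sub_cancel_left, real_inner_smul_right, real_inner_smul_right,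
          EuclideanSpace.inner_single_right] at h1
        simp only [one_mul, conj_trivial] at h1
        have h2 := hdR _ hyΩ
        have h3 : σ * (h * u i) ≤ h := by
          refine (le_abs_self _).trans ?_
          rw [abs_mul, hσ, one_mul]
          exact hui i
        exact hmono h2 ⟨h2.1.trans_le h1, by linarith [hδ₀ x (hsuppΩ hx)]⟩ h1
      have hi : ∀ i : Fin n, -((h * u i) ^ 2 * (f'' (d x) + ε)) ≤
          2 * Y x - Y (x + h • EuclideanSpace.single i (1 : ℝ))
          - Y (x - h • EuclideanSpace.single i (1 : ℝ)) := by
        intro i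
        have h1 := hYle i 1 (by norm_num)
        have h2 := hYle i (-1) (by norm_num)
        rw [one_smul, one_mul] at h1
        rw [neg_one_smul, ← sub_eq_add_neg, neg_one_mul, ← sub_eq_add_neg] at h2
        have h3 := hηf (d x) ⟨hτK x hx, hδ₀ x (hsuppΩ hx)⟩ (h * u i) ((hui i).trans hh1.le)
        linarith
      calc h ^ 2 * (V (d x) * Y x - ε) ≤ -(h ^ 2 * (f'' (d x) + ε)) := by
            have := hfV _ (hdR x (hsuppΩ hx))
            have h4 : h ^ 2 * (V (d x) * Y x - ε) ≤ h ^ 2 * (-f'' (d x) - ε) := by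
              gcongr; linarith
            linarith
        _ = ∑ i, -((h * u i) ^ 2 * (f'' (d x) + ε)) := by
            rw [Finset.sum_neg_distrib, ← Finset.sum_mul]
            simp only [mul_pow]
            rw [← Finset.mul_sum, hu2, mul_one]
        _ ≤ _ := Finset.sum_le_sum fun i _ => hi i
    have hDi : ∀ i : Fin n, Integrable fun x => Q x *
        (2 * Y x - Y (x + h • EuclideanSpace.single i (1 : ℝ))
          - Y (x - h • EuclideanSpace.single i (1 : ℝ))) := fun i =>
      Continuous.integrable_of_hasCompactSupport (by fun_prop) hQs.mul_right
    have hfin : h ^ 2 * ((∫ x, g x ^ 2 * V (d x)) - ε * ∫ x, Q x) ≤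
        ∑ i : Fin n, ∫ x, (g (x + h • EuclideanSpace.single i (1 : ℝ)) - g x) ^ 2 := by
      calc h ^ 2 * ((∫ x, g x ^ 2 * V (d x)) - ε * ∫ x, Q x)
          = ∫ x, h ^ 2 * (g x ^ 2 * V (d x) - ε * Q x) := by
            rw [integral_const_mul, integral_sub hW (hQi.const_mul ε), integral_const_mul]
        _ ≤ ∫ x, ∑ i : Fin n, Q x * (2 * Y x - Y (x + h • EuclideanSpace.single i (1 : ℝ))
              - Y (x - h • EuclideanSpace.single i (1 : ℝ))) := by
            refine integral_mono ((hW.sub (hQi.const_mul ε)).const_mul _)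
              (integrable_finsetSum _ fun i _ => hDi i) fun x => ?_
            simp only
            by_cases hx : x ∈ tsupport g
            · rw [← Finset.mul_sum]
              have h1 := mul_le_mul_of_nonneg_left (hpt x hx) (hQnn x)
              have h2 : Q x * Y x = g x ^ 2 := div_mul_cancel₀ _ (hYpos x (hsuppΩ hx)).ne'
              rw [← h2]
              linarith
            · simp [hQ0 x hx, hg0 x hx]
        _ = ∑ i : Fin n, ∫ x, Q x * (2 * Y x - Y (x + h • EuclideanSpace.single i (1 : ℝ))
              - Y (x - h • EuclideanSpace.single i (1 : ℝ))) :=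
            integral_finsetSum _ fun i _ => hDi i
        _ ≤ _ := Finset.sum_le_sum fun i _ =>
            integral_mul_second_difference_le hg.continuous hsupp hY hQ hQs _ (hpic i)
    have e : ∑ i : Fin n, ∫ x, ((g (x + h • EuclideanSpace.single i (1 : ℝ)) - g x) / h) ^ 2 =
        (∑ i : Fin n, ∫ x, (g (x + h • EuclideanSpace.single i (1 : ℝ)) - g x) ^ 2) / h ^ 2 := by
      simp only [div_pow, integral_div, Finset.sum_div]
    rw [e, le_div_iff₀ (by positivity)]
    linarith
  have hlim : Tendsto (fun ε : ℝ => (∫ x, ‖fderiv ℝ g x‖ ^ 2) + ε * ∫ x, Q x) (𝓝[>] 0)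
      (𝓝 ((∫ x, ‖fderiv ℝ g x‖ ^ 2) + 0 * ∫ x, Q x)) :=
    (Continuous.tendsto (by fun_prop) 0).mono_left nhdsWithin_le_nhds
  rw [zero_mul, add_zero] at hlim
  exact ge_of_tendsto hlim (eventually_mem_nhdsWithin.mono fun ε hε => main ε hε)

/-- The Hardy inequality on a convex set with a remainder term of order `m - 2`, up to a radius
larger than the inner radius. -/
lemma hardy_remainder_of_lt {n : ℕ} {Ω : Set (EuclideanSpace ℝ (Fin n))}
    (hΩo : IsOpen Ω) (hΩconv : Convex ℝ Ω) (hΩproper : Ω ≠ univ) {δ₀ R m : ℝ} (hm : 1 < m)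
    (hδ₀ : ∀ x ∈ Ω, Metric.infDist x (frontier Ω) ≤ δ₀) (hR0 : 0 < R) (hR : δ₀ < R)
    {g : EuclideanSpace ℝ (Fin n) → ℝ} (hg : ContDiff ℝ 1 g) (hsupp : HasCompactSupport g)
    (hsuppΩ : tsupport g ⊆ Ω) :
    ∫ x, g x ^ 2 * (1 / 4 * (1 / Metric.infDist x (frontier Ω) ^ 2) +
      m ^ 2 / (2 * m + 1) / R ^ m * (1 / Metric.infDist x (frontier Ω) ^ (2 - m))) ≤
      ∫ x, ‖fderiv ℝ g x‖ ^ 2 := by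
  have hm0 : 0 < m := by linarith
  have hRm : 0 < R ^ m := Real.rpow_pos_of_pos hR0 m
  set β := 1 / ((2 * m + 1) * R ^ m) with hβ
  have hβ0 : 0 < β := by positivity
  have hβR : (2 * m + 1) * β * R ^ m = 1 := by rw [hβ]; field_simp
  have hβt : ∀ t ∈ Ioo 0 R, (2 * m + 1) * β * t ^ m ≤ 1 := fun t ht => by
    have := Real.rpow_le_rpow ht.1.le ht.2.le hm0.le
    calc (2 * m + 1) * β * t ^ m ≤ (2 * m + 1) * β * R ^ m := by gcongr
      _ = 1 := hβR
  have half : ∀ t : ℝ, 0 < t → 0 < t ^ (1 / 2 : ℝ) := fun t ht => Real.rpow_pos_of_pos ht _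
  have e1 : ∀ t : ℝ, 0 < t → t ^ (m + 1 / 2) = t ^ m * t ^ (1 / 2 : ℝ) :=
    fun t ht => Real.rpow_add ht _ _
  have e2 : ∀ t : ℝ, 0 < t → t ^ ((1 / 2 : ℝ) - 1) = t ^ (1 / 2 : ℝ) / t :=
    fun t ht => Real.rpow_sub_one ht.ne' _
  have e3 : ∀ t : ℝ, 0 < t → t ^ ((1 / 2 : ℝ) - 1 - 1) = t ^ (1 / 2 : ℝ) / t / t :=
    fun t ht => by rw [Real.rpow_sub_one ht.ne', e2 t ht]
  have e4 : ∀ t : ℝ, 0 < t → t ^ (m + 1 / 2 - 1) = t ^ m * t ^ (1 / 2 : ℝ) / t :=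
    fun t ht => by rw [Real.rpow_sub_one ht.ne', e1 t ht]
  have e5 : ∀ t : ℝ, 0 < t → t ^ (m + 1 / 2 - 1 - 1) = t ^ m * t ^ (1 / 2 : ℝ) / t / t :=
    fun t ht => by rw [Real.rpow_sub_one ht.ne', e4 t ht]
  have e6 : ∀ t : ℝ, 0 < t → t ^ (2 - m) = t ^ 2 / t ^ m := fun t ht => by
    rw [Real.rpow_sub ht]; norm_num
  have hc : ∀ p : ℝ, ContinuousOn (fun t : ℝ => t ^ p) (Ioi 0) := fun p t ht =>
    (Real.continuousAt_rpow_const t p (Or.inl (ne_of_gt ht))).continuousWithinAt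
  have hd : ∀ p t : ℝ, 0 < t → HasDerivAt (fun t : ℝ => t ^ p) (p * t ^ (p - 1)) t :=
    fun p t ht => Real.hasDerivAt_rpow_const (Or.inl ht.ne')
  refine integral_sq_mul_potential_le (R := R)
    (V := fun t => 1 / 4 * (1 / t ^ 2) + m ^ 2 / (2 * m + 1) / R ^ m * (1 / t ^ (2 - m)))
    (f := fun t => t ^ (1 / 2 : ℝ) - β * t ^ (m + 1 / 2))
    (f' := fun t => 1 / 2 * t ^ ((1 / 2 : ℝ) - 1) - β * ((m + 1 / 2) * t ^ (m + 1 / 2 - 1)))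
    (f'' := fun t => 1 / 2 * ((1 / 2 - 1) * t ^ ((1 / 2 : ℝ) - 1 - 1)) -
      β * ((m + 1 / 2) * ((m + 1 / 2 - 1) * t ^ (m + 1 / 2 - 1 - 1))))
    hΩo hΩconv hΩproper hδ₀ hR ?_ ?_ ?_ ?_ ?_ ?_ ?_ ?_ hg hsupp hsuppΩ
  · exact (Real.continuous_rpow_const (by norm_num)).sub
      (continuous_const.mul (Real.continuous_rpow_const (by linarith)))
  · exact fun t ht => (hd _ t ht).sub ((hd _ t ht).const_mul β)
  · exact fun t ht => ((hd _ t ht).const_mul _).sub (((hd _ t ht).const_mul _).const_mul β)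
  · exact (continuousOn_const.mul (continuousOn_const.mul (hc _))).sub
      (continuousOn_const.mul (continuousOn_const.mul (continuousOn_const.mul (hc _))))
  · refine (continuousOn_const.mul (continuousOn_const.div (continuous_pow 2).continuousOn
      fun t ht => ?_)).add (continuousOn_const.mul (continuousOn_const.div (hc _) fun t ht => ?_))
    · exact (pow_pos (mem_Ioi.1 ht) 2).ne'
    · exact (Real.rpow_pos_of_pos ht _).ne'
  · intro t ht
    have hp := half t ht.1
    have hq := Real.rpow_pos_of_pos ht.1 m
    have h1 : β * t ^ m < 1 := by
      have := hβt t ht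
      nlinarith [mul_pos hβ0 hq]
    simp only [e1 t ht.1]
    nlinarith
  · refine monotoneOn_of_hasDerivWithinAt_nonneg (convex_Ioo 0 R)
      (f' := fun t => 1 / 2 * t ^ ((1 / 2 : ℝ) - 1) - β * ((m + 1 / 2) * t ^ (m + 1 / 2 - 1)))
      ?_ ?_ ?_
    · exact ((Real.continuous_rpow_const (by norm_num)).sub
        (continuous_const.mul (Real.continuous_rpow_const (by linarith)))).continuousOn
    · intro t ht
      rw [interior_Ioo] at ht
      exact ((hd _ t ht.1).sub ((hd _ t ht.1).const_mul β)).hasDerivWithinAt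
    · intro t ht
      rw [interior_Ioo] at ht
      have h0 := ht.1
      have hp := half t ht.1
      have h2 : 0 ≤ 1 - (2 * m + 1) * β * t ^ m := by linarith [hβt t ht]
      simp only [e2 t ht.1, e4 t ht.1]
      have e : 1 / 2 * (t ^ (1 / 2 : ℝ) / t) -
          β * ((m + 1 / 2) * (t ^ m * t ^ (1 / 2 : ℝ) / t)) =
          t ^ (1 / 2 : ℝ) / t / 2 * (1 - (2 * m + 1) * β * t ^ m) := by ring
      rw [e]
      positivity
  · intro t ht
    have h0 := ht.1
    have hp := half t ht.1
    have hq := Real.rpow_pos_of_pos ht.1 m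
    have hk : m ^ 2 / (2 * m + 1) / R ^ m = m ^ 2 * β := by rw [hβ]; field_simp
    simp only [e1 t ht.1, e3 t ht.1, e5 t ht.1, e6 t ht.1, hk]
    set r := t ^ (1 / 2 : ℝ)
    set p := t ^ m
    have e : -((1 / 4 * (1 / t ^ 2) + m ^ 2 * β * (1 / (t ^ 2 / p))) * (r - β * (p * r))) -
        (1 / 2 * ((1 / 2 - 1) * (r / t / t)) -
          β * ((m + 1 / 2) * ((m + 1 / 2 - 1) * (p * r / t / t)))) =
        m ^ 2 * β ^ 2 * p ^ 2 * r / t ^ 2 := by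
      field_simp
      ring
    have : 0 ≤ m ^ 2 * β ^ 2 * p ^ 2 * r / t ^ 2 := by positivity
    linarith

lemma integrable_sq_div_infDist_frontier_rpow {n : ℕ} {Ω : Set (EuclideanSpace ℝ (Fin n))}
    (hΩo : IsOpen Ω) (hΩproper : Ω ≠ univ) (p : ℝ)
    {g : EuclideanSpace ℝ (Fin n) → ℝ} (hg : Continuous g) (hsupp : HasCompactSupport g)
    (hsuppΩ : tsupport g ⊆ Ω) :
    Integrable fun x => |g x| ^ 2 / Metric.infDist x (frontier Ω) ^ p := by
  have ht : tsupport (fun x => |g x| ^ 2 / Metric.infDist x (frontier Ω) ^ p) ⊆ tsupport g :=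
    closure_mono fun x hx h0 => hx (by simp [h0])
  refine Continuous.integrable_of_hasCompactSupport ?_
    (hsupp.of_isClosed_subset (isClosed_tsupport _) ht)
  refine ContinuousOn.continuous_of_tsupport_subset (s := Ω) ?_ hΩo (ht.trans hsuppΩ)
  refine (hg.abs.pow 2).continuousOn.div
    ((Metric.continuous_infDist_pt _).continuousOn.rpow_const fun x hx =>
      Or.inl (infDist_frontier_pos hΩo hΩproper hx).ne') fun x hx =>
      (Real.rpow_pos_of_pos (infDist_frontier_pos hΩo hΩproper hx) _).ne'

/-- The Hardy inequality on a convex set of finite inner radius with a remainder term. -/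
lemma hardy_remainder {n : ℕ} {Ω : Set (EuclideanSpace ℝ (Fin n))}
    (hΩo : IsOpen Ω) (hΩconv : Convex ℝ Ω) (hΩproper : Ω ≠ univ) {δ₀ m : ℝ} (hm : 1 < m)
    (hδ₀ : ∀ x ∈ Ω, Metric.infDist x (frontier Ω) ≤ δ₀) (hδ₀pos : 0 < δ₀)
    {g : EuclideanSpace ℝ (Fin n) → ℝ} (hg : ContDiff ℝ 1 g) (hsupp : HasCompactSupport g)
    (hsuppΩ : tsupport g ⊆ Ω) :
    1 / 4 * (∫ x, |g x| ^ 2 / Metric.infDist x (frontier Ω) ^ 2) + m ^ 2 / (2 * m + 1) / δ₀ ^ m *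
      (∫ x, |g x| ^ 2 / Metric.infDist x (frontier Ω) ^ (2 - m)) ≤
      ∫ x, ‖fderiv ℝ g x‖ ^ 2 := by
  have i1 := integrable_sq_div_infDist_frontier_rpow hΩo hΩproper 2 hg.continuous hsupp hsuppΩ
  simp only [Real.rpow_two] at i1
  have i2 := integrable_sq_div_infDist_frontier_rpow hΩo hΩproper (2 - m) hg.continuous hsupp
    hsuppΩ
  have hlim : Tendsto (fun R : ℝ => 1 / 4 * (∫ x, |g x| ^ 2 / Metric.infDist x (frontier Ω) ^ 2) +
      m ^ 2 / (2 * m + 1) / R ^ m *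
        (∫ x, |g x| ^ 2 / Metric.infDist x (frontier Ω) ^ (2 - m))) (𝓝[>] δ₀)
      (𝓝 (1 / 4 * (∫ x, |g x| ^ 2 / Metric.infDist x (frontier Ω) ^ 2) +
      m ^ 2 / (2 * m + 1) / δ₀ ^ m *
        (∫ x, |g x| ^ 2 / Metric.infDist x (frontier Ω) ^ (2 - m)))) := by
    refine Tendsto.mono_left ?_ nhdsWithin_le_nhds
    exact tendsto_const_nhds.add ((tendsto_const_nhds.div
      (Real.continuousAt_rpow_const δ₀ m (Or.inl hδ₀pos.ne'))
      (Real.rpow_pos_of_pos hδ₀pos m).ne').mul_const _)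
  refine le_of_tendsto hlim (eventually_mem_nhdsWithin.mono fun R hR => ?_)
  refine le_trans (le_of_eq ?_) (hardy_remainder_of_lt hΩo hΩconv hΩproper hm hδ₀
    (hδ₀pos.trans hR) hR hg hsupp hsuppΩ)
  rw [← integral_const_mul, ← integral_const_mul,
    ← integral_add (i1.const_mul _) (i2.const_mul _)]
  congr 1
  ext x
  rw [sq_abs]
  ring

theorem stmt_19 (n : ℕ) (Ω : Set (EuclideanSpace ℝ (Fin n)))
    (hΩo : IsOpen Ω) (hΩconv : Convex ℝ Ω) (hΩne : Ω.Nonempty) (hΩproper : Ω ≠ Set.univ)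
    (δ₀ : ℝ) (hδ₀ : IsLUB ((fun x => Metric.infDist x (frontier Ω)) '' Ω) δ₀)
    (m ν lam c jν : ℝ)
    (hm : 1 < m) (hν : ν ∈ Set.Icc 0 (1 / m))
    (hlam : lam ∈ Set.Ico 0 ((1 + ν * m) / 2))
    (hc : 0 < c)
    (hjν_pos : 0 < jν) (hjν_zero : besselJ ν jν = 0)
    (hjν_first : ∀ t ∈ Set.Ioo 0 jν, 0 < besselJ ν t)
    (hcm : 2 * c / m ∈ Set.Ioo 0 jν)
    (hroot : (1 - 2 * lam) * besselJ ν (2 * c / m)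
      + 2 * c * deriv (besselJ ν) (2 * c / m) = 0)
    (g : EuclideanSpace ℝ (Fin n) → ℝ)
    (hg : ContDiff ℝ 1 g) (hsupp : HasCompactSupport g) (hsuppΩ : tsupport g ⊆ Ω)
    (hL2 : IntegrableOn (fun x => ‖fderiv ℝ g x‖ ^ 2) Ω) :
    (1 - ν ^ 2 * m ^ 2) / 4 * (∫ x in Ω, |g x| ^ 2 / (Metric.infDist x (frontier Ω)) ^ 2)
      + (c ^ 2 + (m - 1) * (lam - lam ^ 2)) / δ₀ ^ m *
        (∫ x in Ω, |g x| ^ 2 / (Metric.infDist x (frontier Ω)) ^ ((2:ℝ) - m))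
    ≤ 4 * ((1 + ν * m) / 2 - lam ^ 2) * (∫ x in Ω, ‖fderiv ℝ g x‖ ^ 2) := by
  have hm0 : 0 < m := by linarith
  have hδ : ∀ x ∈ Ω, Metric.infDist x (frontier Ω) ≤ δ₀ := fun x hx =>
    hδ₀.1 (mem_image_of_mem _ hx)
  have hδ₀pos : 0 < δ₀ := by
    obtain ⟨x, hx⟩ := hΩne
    exact (infDist_frontier_pos hΩo hΩproper hx).trans_le (hδ x hx)
  have hg0 : ∀ x, x ∉ Ω → g x = 0 := fun x hx =>
    image_eq_zero_of_notMem_tsupport fun h => hx (hsuppΩ h)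
  have hdg0 : ∀ x, x ∉ Ω → fderiv ℝ g x = 0 := fun x hx =>
    image_eq_zero_of_notMem_tsupport fun h => hx (hsuppΩ (tsupport_fderiv_subset ℝ h))
  rw [setIntegral_eq_integral_of_forall_compl_eq_zero (fun x hx => by simp [hg0 x hx]),
    setIntegral_eq_integral_of_forall_compl_eq_zero (fun x hx => by simp [hg0 x hx]),
    setIntegral_eq_integral_of_forall_compl_eq_zero (fun x hx => by simp [hdg0 x hx])]
  have hardy := hardy_remainder hΩo hΩconv hΩproper hm hδ hδ₀pos hg hsupp hsuppΩ
  have i1 := integrable_sq_div_infDist_frontier_rpow hΩo hΩproper 2 hg.continuous hsupp hsuppΩ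
  simp only [Real.rpow_two] at i1
  have i2 := integrable_sq_div_infDist_frontier_rpow hΩo hΩproper (2 - m) hg.continuous hsupp
    hsuppΩ
  have hδm : 0 < δ₀ ^ m := Real.rpow_pos_of_pos hδ₀pos m
  have hcomp : (∫ x, |g x| ^ 2 / Metric.infDist x (frontier Ω) ^ (2 - m)) / δ₀ ^ m ≤
      ∫ x, |g x| ^ 2 / Metric.infDist x (frontier Ω) ^ 2 := by
    rw [← integral_div]
    refine integral_mono (i2.div_const _) i1 fun x => ?_
    by_cases hx : x ∈ Ω
    · have hd := infDist_frontier_pos hΩo hΩproper hx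
      have hdm := Real.rpow_le_rpow hd.le (hδ x hx) hm0.le
      simp only [Real.rpow_sub hd, Real.rpow_two]
      have e : |g x| ^ 2 / (Metric.infDist x (frontier Ω) ^ 2 /
          Metric.infDist x (frontier Ω) ^ m) / δ₀ ^ m =
          |g x| ^ 2 / Metric.infDist x (frontier Ω) ^ 2 *
            (Metric.infDist x (frontier Ω) ^ m / δ₀ ^ m) := by
        have := Real.rpow_pos_of_pos hd m
        field_simp
      rw [e]
      exact mul_le_of_le_one_right (by positivity) ((div_le_one hδm).2 hdm)
    · simp [hg0 x hx]
  have hI2 : 0 ≤ ∫ x, |g x| ^ 2 / Metric.infDist x (frontier Ω) ^ (2 - m) :=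
    integral_nonneg fun x => div_nonneg (sq_nonneg _)
      (Real.rpow_nonneg Metric.infDist_nonneg _)
  have hc2 := sq_le_of_besselJ_root hm hν.1 hjν_first hcm hroot
  have hνm : ν * m ≤ 1 := by
    have := mul_le_mul_of_nonneg_right hν.2 hm0.le
    rwa [one_div, inv_mul_cancel₀ hm0.ne'] at this
  have hνm0 : 0 ≤ ν * m := mul_nonneg hν.1 hm0.le
  rw [div_mul_eq_mul_div _ (δ₀ ^ m), mul_div_assoc] at hardy ⊢
  set I₁ := ∫ x, |g x| ^ 2 / Metric.infDist x (frontier Ω) ^ 2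
  set X := (∫ x, |g x| ^ 2 / Metric.infDist x (frontier Ω) ^ (2 - m)) / δ₀ ^ m
  set D := ∫ x, ‖fderiv ℝ g x‖ ^ 2
  have hX0 : 0 ≤ X := div_nonneg hI2 hδm.le
  set a := (1 + ν * m) / 2 with ha
  have ha1 : a ≤ 1 := by rw [ha]; linarith
  have hνa : ν * m = 2 * a - 1 := by rw [ha]; ring
  have hl0 := hlam.1
  have hla := hlam.2
  have hla2 : lam ^ 2 ≤ a ^ 2 := by gcongr
  have ha2 : a ^ 2 ≤ a := by nlinarith
  have hk : (2 * m - 1) / 4 ≤ m ^ 2 / (2 * m + 1) := by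
    rw [div_le_div_iff₀ (by norm_num) (by linarith)]
    nlinarith
  rw [hνa] at hc2
  have hα : (1 - ν ^ 2 * m ^ 2) / 4 = a - a ^ 2 := by
    rw [← mul_pow, hνa]; ring
  rw [hα]
  have hF : 0 ≤ a - lam ^ 2 := by linarith
  have hardy' : 1 / 4 * I₁ + (2 * m - 1) / 4 * X ≤ D :=
    (add_le_add le_rfl (mul_le_mul_of_nonneg_right hk hX0)).trans hardy
  have hgap : c ^ 2 + (m - 1) * (lam - lam ^ 2) ≤
      a ^ 2 - lam ^ 2 + (a - lam ^ 2) * (2 * m - 1) := by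
    have h1 : (a - lam) ^ 2 ≤ a - lam ^ 2 := by nlinarith
    have h2 : a - lam ^ 2 ≤ m * (a - lam ^ 2) := le_mul_of_one_le_left hF hm.le
    nlinarith
  calc (a - a ^ 2) * I₁ + (c ^ 2 + (m - 1) * (lam - lam ^ 2)) * X
      ≤ (a - a ^ 2) * I₁ + (a ^ 2 - lam ^ 2 + (a - lam ^ 2) * (2 * m - 1)) * X := by gcongr
    _ ≤ (a - lam ^ 2) * I₁ + (a - lam ^ 2) * (2 * m - 1) * X := by
        nlinarith [mul_nonneg (sub_nonneg.2 hla2) (sub_nonneg.2 hcomp)]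
    _ = 4 * (a - lam ^ 2) * (1 / 4 * I₁ + (2 * m - 1) / 4 * X) := by ring
    _ ≤ 4 * (a - lam ^ 2) * D := by gcongr
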